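/- The group G = H_1(q) ⋊ Sp(2,q) (q odd) has exactly q² + 5q conjugacy classes. -/

import Mathlib

/-- The Heisenberg group `H₁(q)`: pairs `(w, z)` with `w ∈ F²`, `z ∈ F`. -/
@[ext]
structure Heis (F : Type*) where
  w : Fin 2 → F
  z : F

namespace Heis

variable {F : Type*} [Field F]

instance : Mul (Heis F) :=
  ⟨fun p q => ⟨p.w + q.w, p.z + q.z + (p.w 0 * q.w 1 - p.w 1 * q.w 0) / 2⟩⟩

@[simp] lemma mul_w (p q : Heis F) : (p * q).w = p.w + q.w := rfl
@[simp] lemma mul_z (p q : Heis F) :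
    (p * q).z = p.z + q.z + (p.w 0 * q.w 1 - p.w 1 * q.w 0) / 2 := rfl

instance : One (Heis F) := ⟨⟨0, 0⟩⟩

@[simp] lemma one_w : (1 : Heis F).w = 0 := rfl
@[simp] lemma one_z : (1 : Heis F).z = 0 := rfl

instance : Inv (Heis F) := ⟨fun p => ⟨-p.w, -p.z⟩⟩

@[simp] lemma inv_w (p : Heis F) : p⁻¹.w = -p.w := rfl
@[simp] lemma inv_z (p : Heis F) : p⁻¹.z = -p.z := rfl

instance instGroup : Group (Heis F) where
  mul_assoc a b c := by
    ext <;> simp [Pi.add_apply] <;> ring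
  one_mul a := by ext <;> simp
  mul_one a := by ext <;> simp
  inv_mul_cancel a := by
    ext
    · simp
    · show -a.z + a.z + ((-a.w) 0 * a.w 1 - (-a.w) 1 * a.w 0) / 2 = 0
      simp only [Pi.neg_apply]
      ring

end Heis

open Matrix SemidirectProduct

abbrev SL2 (F : Type*) [Field F] := Matrix.SpecialLinearGroup (Fin 2) F

/-- The element `g_{(s,w,z)} = s · h_{(w,z)}` of `G = H₁(q) ⋊ Sp(2,q)`. -/
def gel {F : Type*} [Field F] (φ : SL2 F →* MulAut (Heis F))
    (s : SL2 F) (w : Fin 2 → F) (z : F) : Heis F ⋊[φ] SL2 F :=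
  SemidirectProduct.inr s * SemidirectProduct.inl ⟨w, z⟩

namespace SL2

variable {F : Type*} [Field F]

lemma ext_entries {s t : SL2 F} (h00 : s.1 0 0 = t.1 0 0) (h01 : s.1 0 1 = t.1 0 1)
    (h10 : s.1 1 0 = t.1 1 0) (h11 : s.1 1 1 = t.1 1 1) : s = t := by
  apply Subtype.ext
  ext i j
  fin_cases i <;> fin_cases j <;> assumption

lemma det_entries (s : SL2 F) : s.1 0 0 * s.1 1 1 - s.1 0 1 * s.1 1 0 = 1 := by
  rw [← Matrix.det_fin_two]
  exact s.2

/-- The element of `SL2 F` with the given entries. -/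
def ofEntries (a b c d : F) (h : a * d - b * c = 1) : SL2 F :=
  ⟨!![a, b; c, d], by rw [Matrix.det_fin_two_of, h]⟩

lemma mul_eq_mul_iff (s t u v : SL2 F) : s * t = u * v ↔
    s.1 0 0 * t.1 0 0 + s.1 0 1 * t.1 1 0 = u.1 0 0 * v.1 0 0 + u.1 0 1 * v.1 1 0 ∧
    s.1 0 0 * t.1 0 1 + s.1 0 1 * t.1 1 1 = u.1 0 0 * v.1 0 1 + u.1 0 1 * v.1 1 1 ∧
    s.1 1 0 * t.1 0 0 + s.1 1 1 * t.1 1 0 = u.1 1 0 * v.1 0 0 + u.1 1 1 * v.1 1 0 ∧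
    s.1 1 0 * t.1 0 1 + s.1 1 1 * t.1 1 1 = u.1 1 0 * v.1 0 1 + u.1 1 1 * v.1 1 1 := by
  constructor
  · intro h
    have key (i j : Fin 2) : (s.1 * t.1) i j = (u.1 * v.1) i j :=
      congrFun (congrFun (congrArg Subtype.val h) i) j
    simp only [Matrix.mul_apply, Fin.sum_univ_two] at key
    exact ⟨key 0 0, key 0 1, key 1 0, key 1 1⟩
  · rintro ⟨h00, h01, h10, h11⟩
    apply ext_entries <;>
      simpa [Matrix.SpecialLinearGroup.coe_mul, Matrix.mul_apply, Fin.sum_univ_two]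

lemma isConj_iff_exists_mul (s s' : SL2 F) : IsConj s s' ↔ ∃ t, t * s = s' * t := by
  simp only [isConj_iff, mul_inv_eq_iff_eq_mul]

/-- A matrix with trace `t` and determinant one whose form `v ↦ ω(v, s v)` takes the value `d` at
the first basis vector. -/
def companion (t : F) (d : Fˣ) : SL2 F :=
  ofEntries 0 (-(d : F)⁻¹) d t (by simp)

/-- The quadratic form `v ↦ ω(v, s v)`, in coordinates. -/
def form (s : SL2 F) (x y : F) : F :=
  s.1 1 0 * x ^ 2 + (s.1 1 1 - s.1 0 0) * x * y - s.1 0 1 * y ^ 2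

lemma isConj_companion_of_form_eq {s : SL2 F} {t x y : F} {d : Fˣ}
    (ht : s.1 0 0 + s.1 1 1 = t) (h : form s x y = d) : IsConj (companion t d) s := by
  subst ht
  have hdet := det_entries s
  have hd : (d : F) ≠ 0 := d.ne_zero
  unfold form at h
  rw [isConj_iff_exists_mul]
  refine ⟨ofEntries x ((s.1 0 0 * x + s.1 0 1 * y) / d) y ((s.1 1 0 * x + s.1 1 1 * y) / d) ?_, ?_⟩
  · field_simp
    linear_combination h
  · rw [mul_eq_mul_iff]
    simp only [companion, ofEntries, Matrix.of_apply, Matrix.cons_val', Matrix.cons_val_zero,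
      Matrix.cons_val_one, Matrix.cons_val_fin_one]
    refine ⟨by field_simp; ring, ?_, by field_simp; ring, ?_⟩
    · field_simp
      linear_combination x * hdet
    · field_simp
      linear_combination y * hdet

lemma exists_isConj_companion (s : SL2 F) (h1 : s ≠ 1) (h2 : s ≠ -1) :
    ∃ d, IsConj (companion (s.1 0 0 + s.1 1 1) d) s := by
  suffices ∃ x y, form s x y ≠ 0 by
    obtain ⟨x, y, h⟩ := this
    exact ⟨Units.mk0 _ h, isConj_companion_of_form_eq rfl rfl⟩
  by_contra! H
  have h10 : s.1 1 0 = 0 := by simpa [form] using H 1 0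
  have h01 : s.1 0 1 = 0 := by simpa [form] using H 0 1
  have h11 : s.1 1 1 = s.1 0 0 := by simpa [form, h10, h01, sub_eq_zero] using H 1 1
  have hdet := det_entries s
  rw [h10, h01, h11] at hdet
  rcases mul_self_eq_one_iff.mp (by simpa using hdet) with h | h
  · exact h1 (ext_entries (by simp [h]) (by simp [h01]) (by simp [h10]) (by simp [h11, h]))
  · exact h2 (ext_entries (by simp [h]) (by simp [h01]) (by simp [h10]) (by simp [h11, h]))

lemma trace_eq_of_isConj {s s' : SL2 F} (h : IsConj s s') :
    s.1 0 0 + s.1 1 1 = s'.1 0 0 + s'.1 1 1 := by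
  obtain ⟨c, rfl⟩ := isConj_iff.mp h
  rw [← Matrix.trace_fin_two, ← Matrix.trace_fin_two]
  have : ((c * s * c⁻¹ : SL2 F) : Matrix (Fin 2) (Fin 2) F) =
      (c : Matrix (Fin 2) (Fin 2) F) * s.1 * (c⁻¹ : SL2 F).1 := by simp
  rw [this, Matrix.trace_mul_cycle]
  have hc : (c⁻¹ : SL2 F).1 * c.1 = 1 := by
    rw [← Matrix.SpecialLinearGroup.coe_mul]; simp
  rw [hc, one_mul]

lemma companion_apply_one_zero (t : F) (d : Fˣ) : (companion t d).1 1 0 = d := rfl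

lemma companion_trace (t : F) (d : Fˣ) :
    (companion t d).1 0 0 + (companion t d).1 1 1 = t := zero_add t

lemma form_companion (t x y : F) (d : Fˣ) :
    form (companion t d) x y = d * x ^ 2 + t * x * y + (d : F)⁻¹ * y ^ 2 := by
  simp [form, companion, ofEntries]

lemma form_eq_of_mul_eq {s s' t : SL2 F} (h : t * s = s' * t) (x y : F) :
    form s x y = form s' (t.1 0 0 * x + t.1 0 1 * y) (t.1 1 0 * x + t.1 1 1 * y) := by
  obtain ⟨h00, h01, h10, h11⟩ := (mul_eq_mul_iff _ _ _ _).mp h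
  have hdet := det_entries t
  unfold form
  linear_combination
    (t.1 0 0 * x + t.1 0 1 * y) * (x * h10 + y * h11) -
    (t.1 1 0 * x + t.1 1 1 * y) * (x * h00 + y * h01) -
    (s.1 1 0 * x ^ 2 + (s.1 1 1 - s.1 0 0) * x * y - s.1 0 1 * y ^ 2) * hdet

lemma not_isConj_one_companion (t : F) (d : Fˣ) : ¬ IsConj 1 (companion t d) := by
  rw [isConj_one_right]
  intro h
  exact d.ne_zero (by rw [← companion_apply_one_zero t d, h]; rfl)

lemma not_isConj_neg_one_companion (t : F) (d : Fˣ) : ¬ IsConj (-1) (companion t d) := by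
  rw [isConj_iff_exists_mul]
  rintro ⟨c, h⟩
  have h' : companion t d = -1 := by
    rw [mul_neg, mul_one, ← neg_one_mul] at h
    exact (mul_right_cancel h).symm
  exact d.ne_zero (by rw [← companion_apply_one_zero t d, h']; simp)

lemma isConj_companion_of_isSquare (t : F) {d e : Fˣ} (h : IsSquare (d * e : F)) :
    IsConj (companion t d) (companion t e) := by
  obtain ⟨r, hr⟩ := h
  have he : (e : F) ≠ 0 := e.ne_zero
  refine isConj_companion_of_form_eq (x := r / e) (y := 0) (companion_trace t e) ?_
  rw [form_companion]
  field_simp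
  linear_combination -hr

lemma isSquare_of_isConj_companion {t : F} (ht : t ^ 2 = 4) (h2 : (2 : F) ≠ 0) {d e : Fˣ}
    (h : IsConj (companion t d) (companion t e)) : IsSquare (d * e : F) := by
  obtain ⟨c, hc⟩ := (isConj_iff_exists_mul _ _).mp h
  have key := form_eq_of_mul_eq hc 1 0
  have he : (e : F) ≠ 0 := e.ne_zero
  simp only [form_companion, one_pow, mul_one, mul_zero, add_zero, zero_pow two_ne_zero] at key
  refine ⟨e * c.1 0 0 + t / 2 * c.1 1 0, ?_⟩
  field_simp at key ⊢
  linear_combination 4 * key - c.1 1 0 ^ 2 * ht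

lemma ringChar_ne_two_of_two_ne_zero (h2 : (2 : F) ≠ 0) : ringChar F ≠ 2 := by
  intro h
  have := ringChar.Nat.cast_ringChar (R := F)
  rw [h, Nat.cast_two] at this
  exact h2 this

lemma isConj_companion_of_sq_ne_four [Finite F] {t : F} (ht : t ^ 2 ≠ 4) (h2 : (2 : F) ≠ 0)
    (d e : Fˣ) : IsConj (companion t d) (companion t e) := by
  have := Fintype.ofFinite F
  have he : (e : F) ≠ 0 := e.ne_zero
  have hchar := ringChar_ne_two_of_two_ne_zero h2
  have ha : 1 - t ^ 2 / 4 ≠ 0 := by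
    have h4 : (4 : F) ≠ 0 := by
      rw [show (4 : F) = 2 * 2 by norm_num]
      exact mul_ne_zero h2 h2
    intro h
    field_simp at h
    exact ht (by linear_combination -h)
  obtain ⟨u, y, huy⟩ := FiniteField.exists_root_sum_quadratic
    (f := (Polynomial.X ^ 2 : Polynomial F))
    (g := Polynomial.C (1 - t ^ 2 / 4) * Polynomial.X ^ 2 + Polynomial.C 0 * Polynomial.X +
      Polynomial.C (-(d * e : F)))
    (Polynomial.degree_X_pow 2) (Polynomial.degree_quadratic ha)
    (FiniteField.odd_card_of_char_ne_two hchar)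
  simp only [Polynomial.eval_pow, Polynomial.eval_X, Polynomial.eval_add, Polynomial.eval_mul,
    Polynomial.eval_C] at huy
  refine isConj_companion_of_form_eq (x := (u - t * y / 2) / e) (y := y) (companion_trace t e) ?_
  rw [form_companion]
  have h4 : (4 : F) = 2 ^ 2 := by norm_num
  rw [h4] at huy
  field_simp at huy ⊢
  linear_combination huy

lemma isSquare_mul_of_not_isSquare [Finite F] (h2 : (2 : F) ≠ 0) {a b : F} (ha : ¬ IsSquare a)
    (hb : ¬ IsSquare b) : IsSquare (a * b) := by
  classical
  have := Fintype.ofFinite F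
  have hchar := ringChar_ne_two_of_two_ne_zero h2
  have hab : a * b ≠ 0 := by
    refine mul_ne_zero ?_ ?_ <;> rintro rfl <;> simp_all
  rw [← quadraticChar_one_iff_isSquare hab, map_mul,
    quadraticChar_neg_one_iff_not_isSquare.mpr ha, quadraticChar_neg_one_iff_not_isSquare.mpr hb]
  norm_num

/-- Representatives of the conjugacy classes of `SL2 F`, where `ε` is a nonsquare. -/
def classRep (ε : Fˣ) : F ⊕ Fin 4 → SL2 F :=
  Sum.elim (fun t => companion t 1) ![1, -1, companion 2 ε, companion (-2) ε]

lemma classRep_injective (h2 : (2 : F) ≠ 0) {ε : Fˣ} (hε : ¬ IsSquare (ε : F)) :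
    Function.Injective (fun i => ConjClasses.mk (classRep ε i)) := by
  have h22 : (2 : F) ≠ -2 := fun h => mul_ne_zero h2 h2 (by linear_combination h)
  have h1ε {t t' : F} (ht : t' ^ 2 = 4) : ¬ IsConj (companion t 1) (companion t' ε) := by
    intro h
    obtain rfl : t = t' := by simpa only [companion_trace] using trace_eq_of_isConj h
    exact hε (by simpa using isSquare_of_isConj_companion ht h2 h)
  have hpos {t : F} := h1ε (t := t) (t' := 2) (by norm_num)
  have hneg {t : F} := h1ε (t := t) (t' := -2) (by norm_num)
  have hone : ¬ IsConj (1 : SL2 F) (-1) := fun h => h22 <| by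
    have := trace_eq_of_isConj h
    change (1 : F) + 1 = -1 + -1 at this
    linear_combination this
  have hcomp : ¬ IsConj (companion 2 ε) (companion (-2) ε) := fun h => h22 <| by
    simpa only [companion_trace] using trace_eq_of_isConj h
  intro i j hij
  have hij : IsConj (classRep ε i) (classRep ε j) := ConjClasses.mk_eq_mk_iff_isConj.mp hij
  rcases i with t | i <;> rcases j with t' | j
  · have hij : IsConj (companion t 1) (companion t' 1) := hij
    congr 1
    simpa only [companion_trace] using trace_eq_of_isConj hij
  · fin_cases j
    · exact absurd hij.symm (not_isConj_one_companion _ _)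
    · exact absurd hij.symm (not_isConj_neg_one_companion _ _)
    · exact absurd hij hpos
    · exact absurd hij hneg
  · fin_cases i
    · exact absurd hij (not_isConj_one_companion _ _)
    · exact absurd hij (not_isConj_neg_one_companion _ _)
    · exact absurd hij.symm hpos
    · exact absurd hij.symm hneg
  · fin_cases i <;> fin_cases j <;> first
    | rfl
    | exact absurd hij hone
    | exact absurd hij.symm hone
    | exact absurd hij hcomp
    | exact absurd hij.symm hcomp
    | exact absurd hij (not_isConj_one_companion _ _)
    | exact absurd hij.symm (not_isConj_one_companion _ _)
    | exact absurd hij (not_isConj_neg_one_companion _ _)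
    | exact absurd hij.symm (not_isConj_neg_one_companion _ _)

lemma classRep_surjective [Finite F] (h2 : (2 : F) ≠ 0) {ε : Fˣ} (hε : ¬ IsSquare (ε : F)) :
    Function.Surjective (fun i => ConjClasses.mk (classRep ε i)) := by
  intro c
  induction c using Quotient.inductionOn with | _ s
  suffices ∃ i, IsConj (classRep ε i) s from
    this.imp fun i hi => ConjClasses.mk_eq_mk_iff_isConj.mpr hi
  by_cases h1 : s = 1
  · exact ⟨.inr 0, h1 ▸ IsConj.refl _⟩
  by_cases h1' : s = -1
  · exact ⟨.inr 1, h1' ▸ IsConj.refl _⟩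
  obtain ⟨d, hd⟩ := exists_isConj_companion s h1 h1'
  generalize s.1 0 0 + s.1 1 1 = t at hd
  by_cases hsq : IsSquare (d : F)
  · exact ⟨.inl t, (isConj_companion_of_isSquare t (by simpa using hsq)).trans hd⟩
  by_cases ht : t ^ 2 = 4
  · have hdε := (isConj_companion_of_isSquare t (isSquare_mul_of_not_isSquare h2 hε hsq)).trans hd
    have ht' : t ^ 2 = 2 ^ 2 := by rw [ht]; norm_num
    rcases sq_eq_sq_iff_eq_or_eq_neg.mp ht' with rfl | rfl
    · exact ⟨.inr 2, hdε⟩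
    · exact ⟨.inr 3, hdε⟩
  · exact ⟨.inl t, (isConj_companion_of_sq_ne_four ht h2 1 d).trans hd⟩

theorem card_conjClasses [Finite F] (h2 : (2 : F) ≠ 0) :
    Nat.card (ConjClasses (SL2 F)) = Nat.card F + 4 := by
  have hchar := ringChar_ne_two_of_two_ne_zero h2
  obtain ⟨ε, hε⟩ := FiniteField.exists_nonsquare hchar
  have hε0 : ε ≠ 0 := by rintro rfl; simp at hε
  have hbij := And.intro (classRep_injective h2 (ε := Units.mk0 ε hε0) hε)
    (classRep_surjective h2 (ε := Units.mk0 ε hε0) hε)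
  rw [← Nat.card_eq_of_bijective _ hbij, Nat.card_sum]
  simp

/-- The lower unitriangular matrix with entry `b`. -/
def lower (b : F) : SL2 F := ofEntries 1 0 b 1 (by simp)

end SL2

namespace Heis

variable {F : Type*} [Field F] {φ : SL2 F →* MulAut (Heis F)}

/-- The element of `Heis F ⋊[φ] SL2 F` with the given coordinates. -/
def semidirectMk (φ : SL2 F →* MulAut (Heis F)) (x y z : F) (s : SL2 F) : Heis F ⋊[φ] SL2 F :=
  ⟨⟨![x, y], z⟩, s⟩

lemma exists_eq_semidirectMk (g : Heis F ⋊[φ] SL2 F) : ∃ x y z s, g = semidirectMk φ x y z s := by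
  refine ⟨g.left.w 0, g.left.w 1, g.left.z, g.right, ?_⟩
  refine SemidirectProduct.ext (Heis.ext ?_ rfl) rfl
  ext i
  fin_cases i <;> rfl

/-- `SL2 F` acts on the Heisenberg group through its linear action on the first component. -/
abbrev IsLinearAction (φ : SL2 F →* MulAut (Heis F)) : Prop :=
  ∀ (s : SL2 F) (w : Fin 2 → F) (z : F),
    φ s ⟨w, z⟩ = ⟨(s : Matrix (Fin 2) (Fin 2) F).mulVec w, z⟩

lemma isConj_semidirectMk_iff (hφ : IsLinearAction φ) {x y z x' y' z' : F} {s s' : SL2 F} :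
    IsConj (semidirectMk φ x y z s) (semidirectMk φ x' y' z' s') ↔ ∃ (a b : F) (t : SL2 F),
      t * s = s' * t ∧
      a + (t.1 0 0 * x + t.1 0 1 * y) = x' + (s'.1 0 0 * a + s'.1 0 1 * b) ∧
      b + (t.1 1 0 * x + t.1 1 1 * y) = y' + (s'.1 1 0 * a + s'.1 1 1 * b) ∧
      z + (a * (t.1 1 0 * x + t.1 1 1 * y) - b * (t.1 0 0 * x + t.1 0 1 * y)) / 2 =
        z' + (x' * (s'.1 1 0 * a + s'.1 1 1 * b) - y' * (s'.1 0 0 * a + s'.1 0 1 * b)) / 2 := by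
  have key (a b c : F) (t : SL2 F) :
      semidirectMk φ a b c t * semidirectMk φ x y z s =
        semidirectMk φ x' y' z' s' * semidirectMk φ a b c t ↔
      t * s = s' * t ∧
      a + (t.1 0 0 * x + t.1 0 1 * y) = x' + (s'.1 0 0 * a + s'.1 0 1 * b) ∧
      b + (t.1 1 0 * x + t.1 1 1 * y) = y' + (s'.1 1 0 * a + s'.1 1 1 * b) ∧
      z + (a * (t.1 1 0 * x + t.1 1 1 * y) - b * (t.1 0 0 * x + t.1 0 1 * y)) / 2 =
        z' + (x' * (s'.1 1 0 * a + s'.1 1 1 * b) - y' * (s'.1 0 0 * a + s'.1 0 1 * b)) / 2 := by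
    simp only [SemidirectProduct.ext_iff, SemidirectProduct.mul_left, SemidirectProduct.mul_right,
      semidirectMk, hφ, Heis.ext_iff, mul_w, mul_z, funext_iff, Fin.forall_fin_two, Pi.add_apply,
      Matrix.mulVec, dotProduct, Fin.sum_univ_two, Matrix.cons_val_zero, Matrix.cons_val_one,
      Matrix.cons_val_fin_one]
    constructor
    · rintro ⟨⟨⟨h0, h1⟩, hz⟩, hs⟩
      exact ⟨hs, h0, h1, by linear_combination hz⟩
    · rintro ⟨hs, h0, h1, hz⟩
      exact ⟨⟨⟨h0, h1⟩, by linear_combination hz⟩, hs⟩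
  simp only [isConj_iff, mul_inv_eq_iff_eq_mul]
  constructor
  · rintro ⟨g, hg⟩
    obtain ⟨a, b, c, t, rfl⟩ := exists_eq_semidirectMk g
    exact ⟨a, b, t, (key a b c t).mp hg⟩
  · rintro ⟨a, b, t, h⟩
    exact ⟨semidirectMk φ a b 0 t, (key a b 0 t).mpr h⟩

lemma isConj_zero_zero_iff (hφ : IsLinearAction φ) {z z' : F} {s s' : SL2 F} :
    IsConj (semidirectMk φ 0 0 z s) (semidirectMk φ 0 0 z' s') ↔ IsConj s s' ∧ z = z' := by
  rw [isConj_semidirectMk_iff hφ, SL2.isConj_iff_exists_mul]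
  simp only [mul_zero, zero_mul, add_zero, zero_add, sub_zero, zero_div]
  constructor
  · rintro ⟨a, b, t, ht, -, -, hz⟩
    exact ⟨⟨t, ht⟩, hz⟩
  · rintro ⟨⟨t, ht⟩, hz⟩
    exact ⟨0, 0, t, ht, by simp, by simp, hz⟩

lemma isConj_one_zero_lower (hφ : IsLinearAction φ) {b b' : F}
    (h : IsConj (semidirectMk φ 1 0 0 (SL2.lower b)) (semidirectMk φ 1 0 0 (SL2.lower b'))) :
    b = b' := by
  obtain ⟨u, v, t, ht, h0, h1, -⟩ := (isConj_semidirectMk_iff hφ).mp h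
  obtain ⟨h00, -, h10, -⟩ := (SL2.mul_eq_mul_iff _ _ _ _).mp ht
  have hdet := SL2.det_entries t
  simp [SL2.lower, SL2.ofEntries] at h0 h1 h00 h10
  grind

lemma not_isConj_zero_zero_one_zero_lower (hφ : IsLinearAction φ) {z b : F} {s : SL2 F} :
    ¬ IsConj (semidirectMk φ 0 0 z s) (semidirectMk φ 1 0 0 (SL2.lower b)) := by
  intro h
  obtain ⟨u, v, t, -, h0, -, -⟩ := (isConj_semidirectMk_iff hφ).mp h
  simp [SL2.lower, SL2.ofEntries] at h0

lemma exists_isConj_zero_zero_of_fixed (hφ : IsLinearAction φ) (x y z a b : F) (s : SL2 F)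
    (ha : a = x + (s.1 0 0 * a + s.1 0 1 * b)) (hb : b = y + (s.1 1 0 * a + s.1 1 1 * b)) :
    ∃ z', IsConj (semidirectMk φ 0 0 z' s) (semidirectMk φ x y z s) := by
  simp only [isConj_semidirectMk_iff hφ]
  refine ⟨z + (x * (s.1 1 0 * a + s.1 1 1 * b) - y * (s.1 0 0 * a + s.1 0 1 * b)) / 2, a, b,
    1, by simp, by simpa using ha, by simpa using hb, ?_⟩
  simp only [mul_zero, add_zero, sub_zero, zero_div]

lemma exists_isConj_one_zero_lower (hφ : IsLinearAction φ) (h2 : (2 : F) ≠ 0) (x y z : F)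
    (s : SL2 F)
    (H : ∀ a b, a = x + (s.1 0 0 * a + s.1 0 1 * b) → b ≠ y + (s.1 1 0 * a + s.1 1 1 * b)) :
    ∃ b, IsConj (semidirectMk φ 1 0 0 (SL2.lower b)) (semidirectMk φ x y z s) := by
  simp only [isConj_semidirectMk_iff hφ, SL2.mul_eq_mul_iff]
  have hdet := SL2.det_entries s
  have htr : s.1 0 0 + s.1 1 1 = 2 := by
    by_contra htr
    have hD : 2 - (s.1 0 0 + s.1 1 1) ≠ 0 := fun h => htr (by linear_combination -h)
    refine H (((1 - s.1 1 1) * x + s.1 0 1 * y) / (2 - (s.1 0 0 + s.1 1 1)))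
      ((s.1 1 0 * x + (1 - s.1 0 0) * y) / (2 - (s.1 0 0 + s.1 1 1))) ?_ ?_
    · field_simp
      linear_combination x * hdet
    · field_simp
      linear_combination y * hdet
  obtain ⟨p, hp⟩ : ∃ p, s.1 0 0 = 1 + p := ⟨s.1 0 0 - 1, by ring⟩
  have hp' : s.1 1 1 = 1 - p := by linear_combination htr - hp
  rw [hp, hp'] at H hdet
  simp only [hp, hp']
  generalize s.1 0 1 = r at *
  generalize s.1 1 0 = c at *
  by_cases hβ : c * x ^ 2 - 2 * p * x * y - r * y ^ 2 = 0
  · have hw1 : c * x = p * y := by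
      have : (c * x - p * y) ^ 2 = 0 := by linear_combination c * hβ - y ^ 2 * hdet
      linear_combination pow_eq_zero_iff two_ne_zero |>.mp this
    have hw0 : r * y = -(p * x) := by
      have : (r * y + p * x) ^ 2 = 0 := by linear_combination -r * hβ - x ^ 2 * hdet
      linear_combination pow_eq_zero_iff two_ne_zero |>.mp this
    have hc : c = 0 := by
      by_contra hc
      refine H (-(y / c)) 0 ?_ ?_
      · field_simp; linear_combination -hw1
      · field_simp; ring
    have hr : r = 0 := by
      by_contra hr
      refine H 0 (-(x / r)) ?_ ?_
      · field_simp; ring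
      · field_simp; linear_combination -hw0
    have hp0 : p = 0 := by
      have : p ^ 2 = 0 := by rw [hc, hr] at hdet; linear_combination -hdet
      exact pow_eq_zero_iff two_ne_zero |>.mp this
    subst hc hr hp0
    refine ⟨0, ?_⟩
    by_cases hx : x = 0
    · subst hx
      have hy : y ≠ 0 := fun hy => H 0 0 (by simp) (by simp [hy])
      refine ⟨z / y, 0, SL2.ofEntries 0 (-y⁻¹) y 0 (by field_simp; ring), ?_⟩
      simp [SL2.lower, SL2.ofEntries]
      field_simp
      ring
    · refine ⟨0, -(z / x), SL2.ofEntries x 0 y x⁻¹ (by field_simp; ring), ?_⟩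
      simp [SL2.lower, SL2.ofEntries]
      field_simp
      constructor <;> ring
  · obtain ⟨β, hβ'⟩ : ∃ β, β = c * x ^ 2 - 2 * p * x * y - r * y ^ 2 := ⟨_, rfl⟩
    rw [← hβ'] at hβ
    refine ⟨β, -z * (p * x + r * y) / β, -z * (c * x - p * y) / β,
      SL2.ofEntries x ((p * x + r * y) / β) y ((c * x - p * y) / β) ?_, ?_⟩
    · field_simp
      linear_combination -hβ'
    · simp only [SL2.lower, SL2.ofEntries, Matrix.of_apply, Matrix.cons_val', Matrix.cons_val_zero,
        Matrix.cons_val_one, Matrix.cons_val_fin_one]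
      refine ⟨⟨?_, ?_, ?_, ?_⟩, ?_, ?_, ?_⟩
      · field_simp
        ring
      · field_simp
        linear_combination x * hdet
      · field_simp
        ring
      · field_simp
        linear_combination y * hdet
      · field_simp
        linear_combination -z * x * hdet
      · field_simp
        linear_combination -z * y * hdet
      · field_simp
        linear_combination -2 * β * z * hβ'

theorem card_conjClasses_eq (hφ : IsLinearAction φ) [Finite F] (h2 : (2 : F) ≠ 0) :
    Nat.card (ConjClasses (Heis F ⋊[φ] SL2 F)) =
      Nat.card (ConjClasses (SL2 F)) * Nat.card F + Nat.card F := by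
  let f : ConjClasses (SL2 F) × F ⊕ F → ConjClasses (Heis F ⋊[φ] SL2 F) :=
    Sum.elim (fun c => ConjClasses.mk (semidirectMk φ 0 0 c.2 c.1.out))
      (fun b => ConjClasses.mk (semidirectMk φ 1 0 0 (SL2.lower b)))
  have hf : Function.Bijective f := by
    constructor
    · rintro (⟨c, z⟩ | b) (⟨c', z'⟩ | b') h <;>
        have h := ConjClasses.mk_eq_mk_iff_isConj.mp h
      · obtain ⟨hc, hz⟩ := (isConj_zero_zero_iff hφ).mp h
        have hcc : c = c' := by
          rw [← Quotient.out_eq c, ← Quotient.out_eq c']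
          exact Quotient.sound hc
        simp only at hz
        rw [hcc, hz]
      · exact absurd h (not_isConj_zero_zero_one_zero_lower hφ)
      · exact absurd h.symm (not_isConj_zero_zero_one_zero_lower hφ)
      · rw [isConj_one_zero_lower hφ h]
    · intro c
      induction c using Quotient.inductionOn with | _ g
      obtain ⟨x, y, z, s, rfl⟩ := exists_eq_semidirectMk g
      suffices (∃ z' s', IsConj (semidirectMk φ 0 0 z' s') (semidirectMk φ x y z s)) ∨
          ∃ b, IsConj (semidirectMk φ 1 0 0 (SL2.lower b)) (semidirectMk φ x y z s) by
        rcases this with ⟨z', s', h⟩ | ⟨b, h⟩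
        · refine ⟨.inl (ConjClasses.mk s', z'), ConjClasses.mk_eq_mk_iff_isConj.mpr (.trans ?_ h)⟩
          exact (isConj_zero_zero_iff hφ).mpr
            ⟨ConjClasses.mk_eq_mk_iff_isConj.mp (Quotient.out_eq (ConjClasses.mk s')), rfl⟩
        · exact ⟨.inr b, ConjClasses.mk_eq_mk_iff_isConj.mpr h⟩
      by_cases H : ∃ a b, a = x + (s.1 0 0 * a + s.1 0 1 * b) ∧
          b = y + (s.1 1 0 * a + s.1 1 1 * b)
      · obtain ⟨a, b, ha, hb⟩ := H
        obtain ⟨z', h⟩ := exists_isConj_zero_zero_of_fixed hφ x y z a b s ha hb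
        exact .inl ⟨z', s, h⟩
      · exact .inr (exists_isConj_one_zero_lower hφ h2 x y z s
          fun a b ha hb => H ⟨a, b, ha, hb⟩)
  rw [← Nat.card_eq_of_bijective f hf, Nat.card_sum, Nat.card_prod]

end Heis

/-- The group `G = H₁(q) ⋊ Sp(2,q)` (`q` odd) has exactly `q² + 5q`
conjugacy classes. -/
theorem card_conjClasses_heisenberg_sp {F : Type*} [Field F] [Fintype F]
    (q : ℕ) (hF : Fintype.card F = q) (hq : Odd q)
    (φ : SL2 F →* MulAut (Heis F))
    (hφ : ∀ (s : SL2 F) (w : Fin 2 → F) (z : F),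
      φ s ⟨w, z⟩ = ⟨(s : Matrix (Fin 2) (Fin 2) F).mulVec w, z⟩) :
    Nat.card (ConjClasses (Heis F ⋊[φ] SL2 F)) = q ^ 2 + 5 * q := by
  have h2 : (2 : F) ≠ 0 := by
    refine Ring.two_ne_zero fun h => ?_
    rw [FiniteField.even_card_iff_char_two, hF] at h
    exact Nat.not_even_iff_odd.mpr hq (Nat.even_iff.mpr h)
  rw [Heis.card_conjClasses_eq hφ h2, SL2.card_conjClasses h2, Nat.card_eq_fintype_card, hF]
  ring
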